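/- Let λ ⊆ ν be Young diagrams and let p be a positive integer. Then the number of increasing tableaux of shape ν/λ that have M_{(p)} (the minimal increasing tableau of the single-row Young diagram with p boxes, i.e. the row 1,2,…,p) as a rectification equals the binomial coefficient C(r(ν/λ) − 1, |ν/λ| − p) if ν/λ is a nonempty horizontal strip, and equals 0 if ν/λ is empty or is not a horizontal strip. Here a horizontal strip is a skew shape containing at most one box in each column, r(ν/λ) is the number of nonempty rows of ν/λ, and |ν/λ| is its number of boxes. -/

import Mathlib

open Classical

noncomputable section

/-- A straight shape in a poset: a finite lower order ideal, given as a `Finset`. -/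
def StraightShape {L : Type} [PartialOrder L] (lam : Finset L) : Prop :=
  ∀ a ∈ lam, ∀ b : L, b ≤ a → b ∈ lam

/-- The shape (set of boxes) of a partially defined tableau. -/
def shapeOf {L : Type} {V : Type} (T : L → Option V) : Set L := {α | T α ≠ none}

/-- `lam ⊆ nu` is a pair of straight shapes, defining the skew shape `nu / lam`. -/
def IsSkewPair {L : Type} [PartialOrder L] (lam nu : Finset L) : Prop :=
  StraightShape lam ∧ StraightShape nu ∧ lam ⊆ nu

/-- `T` is defined on a skew shape `nu / lam`. -/
def HasSkewShape {L : Type} [PartialOrder L] (T : L → Option ℤ) : Prop :=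
  ∃ lam nu : Finset L, IsSkewPair lam nu ∧ shapeOf T = (nu : Set L) \ (lam : Set L)

/-- `T` is strictly increasing along the partial order. -/
def Increasing {L : Type} [PartialOrder L] (T : L → Option ℤ) : Prop :=
  ∀ a b : L, a < b → ∀ x y : ℤ, T a = some x → T b = some y → x < y

/-- An increasing tableau of skew shape. -/
def IncreasingSkewTableau {L : Type} [PartialOrder L] (T : L → Option ℤ) : Prop :=
  HasSkewShape T ∧ Increasing T

/-- Two boxes are neighbors if one covers the other. -/
def Neighbor {L : Type} [PartialOrder L] (a b : L) : Prop := a ⋖ b ∨ b ⋖ a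

/-- The swap operation `swap_{s,s'}`. -/
def swapVal {L : Type} [PartialOrder L] {V : Type} (s s' : V) (T : L → Option V) :
    L → Option V := fun α =>
  if T α = some s ∧ ∃ β, Neighbor α β ∧ T β = some s' then some s'
  else if T α = some s' ∧ ∃ β, Neighbor α β ∧ T β = some s then some s
  else T α

/-- Integer values extended with a dot `•`. -/
abbrev ZDot : Type := ℤ ⊕ Unit

def toDotted {L : Type} (T : L → Option ℤ) : L → Option ZDot := fun α => (T α).map Sum.inl

/-- Place a dot in every box of `C`. -/
def addDots {L : Type} (C : Finset L) (T : L → Option ZDot) : L → Option ZDot := fun α =>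
  if α ∈ C then some (Sum.inr ()) else T α

/-- Restrict a dotted tableau to its integer-valued boxes. -/
def restrictInt {L : Type} (T : L → Option ZDot) : L → Option ℤ := fun α =>
  (T α).bind (Sum.elim some fun _ => none)

/-- Apply `swap_{a,•}, swap_{a+1,•}, …, swap_{a+n-1,•}` in this (increasing) order. -/
def swapUp {L : Type} [PartialOrder L] (a : ℤ) : ℕ → (L → Option ZDot) → (L → Option ZDot)
  | 0, T => T
  | n + 1, T => swapVal (Sum.inl (a + n)) (Sum.inr ()) (swapUp a n T)

/-- Apply `swap_{b,•}, swap_{b-1,•}, …, swap_{b-n+1,•}` in this (decreasing) order. -/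
def swapDown {L : Type} [PartialOrder L] (b : ℤ) : ℕ → (L → Option ZDot) → (L → Option ZDot)
  | 0, T => T
  | n + 1, T => swapVal (Sum.inl (b - n)) (Sum.inr ()) (swapDown b n T)

/-- All values of `T` lie in the interval `[a, b]`. -/
def ValuesIn {L : Type} (T : L → Option ℤ) (a b : ℤ) : Prop :=
  ∀ (α : L) (x : ℤ), T α = some x → a ≤ x ∧ x ≤ b

/-- `T'` is obtained from `T` by a single forward jeu de taquin slide `jdt_C`,
starting from a set `C` of maximal boxes of the inner shape. -/
def IsForwardSlide {L : Type} [PartialOrder L] (T T' : L → Option ℤ) : Prop :=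
  ∃ (lam nu C : Finset L) (a b : ℤ),
    IsSkewPair lam nu ∧ shapeOf T = (nu : Set L) \ (lam : Set L) ∧ ValuesIn T a b ∧
    (∀ c ∈ C, c ∈ lam ∧ ∀ d ∈ lam, ¬ c < d) ∧
    T' = restrictInt (swapUp a (b - a + 1).toNat (addDots C (toDotted T)))

/-- `T'` is obtained from `T` by a single reverse jeu de taquin slide,
starting from a set `C` of minimal boxes of the complement of the outer shape. -/
def IsReverseSlide {L : Type} [PartialOrder L] (T T' : L → Option ℤ) : Prop :=
  ∃ (lam nu C : Finset L) (a b : ℤ),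
    IsSkewPair lam nu ∧ shapeOf T = (nu : Set L) \ (lam : Set L) ∧ ValuesIn T a b ∧
    (∀ c ∈ C, c ∉ nu ∧ ∀ d : L, d ∉ nu → ¬ d < c) ∧
    T' = restrictInt (swapDown b (b - a + 1).toNat (addDots C (toDotted T)))

/-- Jeu de taquin equivalence: a finite sequence of forward and reverse slides. -/
def JdtEquiv {L : Type} [PartialOrder L] (T T' : L → Option ℤ) : Prop :=
  Relation.ReflTransGen (fun A B => IsForwardSlide A B ∨ IsReverseSlide A B) T T'

/-- `T` is defined on a straight shape. -/
def HasStraightShape {L : Type} [PartialOrder L] (T : L → Option ℤ) : Prop :=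
  ∃ lam : Finset L, StraightShape lam ∧ shapeOf T = (lam : Set L)

/-- `U` is a rectification of `T`: a straight-shape tableau obtained by forward slides. -/
def RectifiesTo {L : Type} [PartialOrder L] (T U : L → Option ℤ) : Prop :=
  Relation.ReflTransGen IsForwardSlide T U ∧ HasStraightShape U

/-- Unique rectification target. -/
def IsURT {L : Type} [PartialOrder L] (U : L → Option ℤ) : Prop :=
  HasStraightShape U ∧ Increasing U ∧
    ∀ T : L → Option ℤ, IncreasingSkewTableau T → RectifiesTo T U →
      ∀ U' : L → Option ℤ, RectifiesTo T U' → U' = U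

/-- The minimal increasing tableau of a shape `θ`: each box `α` receives the maximal
cardinality of a totally ordered subset of `θ` having `α` as its maximal element. -/
def minTab {L : Type} [PartialOrder L] (θ : Finset L) : L → Option ℤ := fun α =>
  if α ∈ θ then
    some ((sSup {n : ℕ | ∃ s : Finset L, (s : Set L) ⊆ (θ : Set L) ∧
      (∀ a ∈ s, ∀ b ∈ s, a ≤ b ∨ b ≤ a) ∧ α ∈ s ∧ (∀ a ∈ s, a ≤ α) ∧ s.card = n} : ℕ) : ℤ)
  else none

/-- A unique rectification poset. -/
def IsURP (L : Type) [PartialOrder L] : Prop :=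
  ∀ lam : Finset L, StraightShape lam → IsURT (minTab lam)

/-- The structure constant `c^ν_{λ,μ}`: the number of increasing tableaux of
shape `ν/λ` that have the minimal increasing tableau `M_μ` as a rectification. -/
def ccoef {L : Type} [PartialOrder L] (lam mu nu : Finset L) : ℕ :=
  Set.ncard {T : L → Option ℤ | Increasing T ∧ shapeOf T = (nu : Set L) \ (lam : Set L) ∧
    RectifiesTo T (minTab mu)}

/-- The minimal increasing tableau of the single-row shape with `p` boxes:
the row `1, 2, …, p`. -/
def rowTab (p : ℕ) : ℕ × ℕ → Option ℤ := fun q =>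
  if q.1 = 0 ∧ q.2 < p then some ((q.2 : ℤ) + 1) else none

/-- Reading the rows from bottom to top, no value is followed by a smaller one in a later row. -/
def NoRowDescent (T : ℕ × ℕ → Option ℤ) : Prop :=
  ∀ α β x y, T α = some x → T β = some y → β.1 < α.1 → x ≤ y

/-- Doubled position of an entry in the order where the dot lies just below `s`. -/
def dotKey (s : ℤ) : ZDot → ℤ
  | Sum.inl x => 2 * x
  | Sum.inr _ => 2 * s - 1

/-- A dotted tableau is strictly increasing when the dot is placed just below `s`. -/
def DotIncreasing {L : Type} [PartialOrder L] (s : ℤ) (T : L → Option ZDot) : Prop :=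
  ∀ α β u v, α < β → T α = some u → T β = some v → dotKey s u < dotKey s v

/-- The shape of a tableau contains every interval between two of its boxes. -/
def ConvexShape {L V : Type} [PartialOrder L] (T : L → Option V) : Prop :=
  ∀ α β γ, α ≤ γ → γ ≤ β → T α ≠ none → T β ≠ none → T γ ≠ none

lemma restrictInt_eq_some {L : Type} {T : L → Option ZDot} {α : L} {x : ℤ} :
    restrictInt T α = some x ↔ T α = some (Sum.inl x) := by
  unfold restrictInt
  rcases T α with _ | _ | _ <;> simp

section General

variable {L : Type} [PartialOrder L]

lemma Neighbor.symm {α β : L} (h : Neighbor α β) : Neighbor β α := Or.symm h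

lemma swapVal_ne_none {V : Type} {s s' : V} {T : L → Option V} {α : L} :
    swapVal s s' T α ≠ none ↔ T α ≠ none := by
  unfold swapVal
  split_ifs with h h' <;> simp_all

lemma swapVal_left {V : Type} {s s' : V} {T : L → Option V} {α β : L}
    (hα : T α = some s) (hβ : T β = some s') (h : Neighbor α β) :
    swapVal s s' T α = some s' := if_pos ⟨hα, β, h, hβ⟩

lemma swapVal_right {V : Type} {s s' : V} (hs : s ≠ s') {T : L → Option V} {α β : L}
    (hα : T α = some s') (hβ : T β = some s) (h : Neighbor α β) :
    swapVal s s' T α = some s := by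
  unfold swapVal
  rw [if_neg (by rw [hα]; rintro ⟨h, -⟩; exact hs (Option.some.inj h).symm),
    if_pos ⟨hα, β, h, hβ⟩]

lemma swapVal_of_ne {V : Type} {s s' u : V} {T : L → Option V} {α : L}
    (hα : T α = some u) (h : u ≠ s) (h' : u ≠ s') : swapVal s s' T α = some u := by
  unfold swapVal
  rw [if_neg (by simp [hα, h]), if_neg (by simp [hα, h']), hα]

lemma swapVal_cases {V : Type} (s s' : V) (T : L → Option V) (α : L) :
    swapVal s s' T α = T α ∨
    (T α = some s ∧ swapVal s s' T α = some s' ∧ ∃ β, Neighbor α β ∧ T β = some s') ∨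
    (T α = some s' ∧ swapVal s s' T α = some s ∧ ∃ β, Neighbor α β ∧ T β = some s) := by
  unfold swapVal
  split_ifs with h h'
  · exact Or.inr (Or.inl ⟨h.1, rfl, h.2⟩)
  · exact Or.inr (Or.inr ⟨h'.1, rfl, h'.2⟩)
  · exact Or.inl rfl

lemma exists_swapVal_eq_some (s : ℤ) (T : L → Option ZDot) (x : ℤ) :
    (∃ α, swapVal (Sum.inl s) (Sum.inr ()) T α = some (Sum.inl x)) ↔
      ∃ α, T α = some (Sum.inl x) := by
  constructor
  · rintro ⟨α, hα⟩
    rcases swapVal_cases (Sum.inl s) (Sum.inr ()) T α with h | ⟨-, h, -⟩ | ⟨-, h, β, -, hβ⟩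
    · exact ⟨α, h ▸ hα⟩
    · simp [hα] at h
    · rw [hα] at h
      exact ⟨β, by rw [hβ, h]⟩
  · rintro ⟨α, hα⟩
    rcases swapVal_cases (Sum.inl s) (Sum.inr ()) T α with h | ⟨h, -, β, hn, hβ⟩ | ⟨h, -⟩
    · exact ⟨α, h ▸ hα⟩
    · rw [hα] at h
      exact ⟨β, by rw [h]; exact swapVal_right (by simp) hβ (hα.trans h) hn.symm⟩
    · simp [hα] at h

lemma ConvexShape.swapVal {V : Type} {s s' : V} {T : L → Option V} (h : ConvexShape T) :
    ConvexShape (swapVal s s' T) := by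
  intro α β γ h1 h2
  simp only [swapVal_ne_none]
  exact h α β γ h1 h2

lemma DotIncreasing.covBy {s : ℤ} {T : L → Option ZDot} (hT : DotIncreasing s T)
    (hc : ConvexShape T) {α β : L} (h : α < β) (hα : T α = some (Sum.inr ()))
    (hβ : T β = some (Sum.inl s)) : α ⋖ β := by
  refine ⟨h, fun γ h1 h2 => ?_⟩
  obtain ⟨w, hw⟩ := Option.ne_none_iff_exists'.1
    (hc α β γ h1.le h2.le (by simp [hα]) (by simp [hβ]))
  have e1 := hT _ _ _ _ h1 hα hw
  have e2 := hT _ _ _ _ h2 hw hβ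
  simp only [dotKey] at e1 e2
  omega

lemma DotIncreasing.covBy_of_neighbor {s : ℤ} {T : L → Option ZDot} (hT : DotIncreasing s T)
    {α β : L} (h : Neighbor α β) (hα : T α = some (Sum.inr ()))
    (hβ : T β = some (Sum.inl s)) : α ⋖ β := by
  rcases h with h | h
  · exact h
  · have := hT _ _ _ _ h.lt hβ hα
    simp only [dotKey] at this
    omega

lemma DotIncreasing.swapVal {s : ℤ} {T : L → Option ZDot} (hT : DotIncreasing s T)
    (hc : ConvexShape T) : DotIncreasing (s + 1) (swapVal (Sum.inl s) (Sum.inr ()) T) := by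
  intro α β u' v' hαβ hu' hv'
  obtain ⟨u, hu⟩ := Option.ne_none_iff_exists'.1
    (swapVal_ne_none.1 (by rw [hu']; simp) : T α ≠ none)
  obtain ⟨v, hv⟩ := Option.ne_none_iff_exists'.1
    (swapVal_ne_none.1 (by rw [hv']; simp) : T β ≠ none)
  have key := hT _ _ _ _ hαβ hu hv
  by_cases hflip : u = Sum.inr () ∧ v = Sum.inl s
  · obtain ⟨rfl, rfl⟩ := hflip
    have hn : Neighbor α β := Or.inl (hT.covBy hc hαβ hu hv)
    rw [swapVal_right (by simp) hu hv hn] at hu'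
    rw [swapVal_left hv hu hn.symm] at hv'
    cases hu'; cases hv'
    simp only [dotKey]; omega
  have aux : ∀ {γ : L} {w w' : ZDot}, T γ = some w →
      _root_.swapVal (Sum.inl s) (Sum.inr ()) T γ = some w' →
      w' = w ∨ (w = Sum.inl s ∧ w' = Sum.inr ()) ∨ (w = Sum.inr () ∧ w' = Sum.inl s) := by
    intro γ w w' hw hw'
    rcases swapVal_cases (Sum.inl s) (Sum.inr ()) T γ with h | ⟨h1, h2, -⟩ | ⟨h1, h2, -⟩ <;>
      simp_all
  have hu2 := aux hu hu'
  have hv2 := aux hv hv'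
  rcases u with x | ⟨⟩ <;> rcases v with y | ⟨⟩ <;> rcases u' with x' | ⟨⟩ <;>
    rcases v' with y' | ⟨⟩ <;> simp [dotKey] at * <;> omega

end General

lemma covBy_cases {α β : ℕ × ℕ} (h : α ⋖ β) :
    (β.1 = α.1 ∧ β.2 = α.2 + 1) ∨ (β.1 = α.1 + 1 ∧ β.2 = α.2) := by
  obtain ⟨i, j⟩ := α
  obtain ⟨k, l⟩ := β
  rw [Prod.mk_covBy_mk_iff, Nat.covBy_iff_add_one_eq, Nat.covBy_iff_add_one_eq] at h
  simp only
  omega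

lemma lt_of_coords {α β : ℕ × ℕ} (h1 : α.1 ≤ β.1) (h2 : α.2 ≤ β.2)
    (h3 : α.1 < β.1 ∨ α.2 < β.2) : α < β := by
  rw [Prod.lt_iff]; omega

lemma NoRowDescent.swapVal {s : ℤ} {T : ℕ × ℕ → Option ZDot} (hT : DotIncreasing s T)
    (hc : ConvexShape T) (hg : NoRowDescent (restrictInt T)) :
    NoRowDescent (restrictInt (swapVal (Sum.inl s) (Sum.inr ()) T)) := by
  simp only [NoRowDescent, restrictInt_eq_some] at hg ⊢
  intro α β x y hα hβ hlt
  rcases swapVal_cases (Sum.inl s) (Sum.inr ()) T α with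
    ha | ⟨-, ha, -⟩ | ⟨ha, ha', δ, hδ, hδs⟩
  · rw [ha] at hα
    rcases swapVal_cases (Sum.inl s) (Sum.inr ()) T β with
      hb | ⟨-, hb, -⟩ | ⟨hb, hb', δ, hδ, hδs⟩
    · exact hg α β x y hα (hb ▸ hβ) hlt
    · simp [hβ] at hb
    · obtain rfl : y = s := by simpa [hβ] using hb'
      have hcov := hT.covBy_of_neighbor hδ hb hδs
      by_cases h1 : δ.1 < α.1
      · exact hg α δ x y hα hδs h1
      rcases covBy_cases hcov with ⟨e1, e2⟩ | ⟨e1, e2⟩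
      · omega
      by_cases h2 : α.2 ≤ δ.2
      · by_cases h3 : α.2 = δ.2
        · have : α = δ := Prod.ext (by omega) h3
          subst this
          rw [hα] at hδs
          simp at hδs
          omega
        · have := hT _ _ _ _ (lt_of_coords (α := α) (β := δ) (by omega) h2 (by omega)) hα hδs
          simp only [dotKey] at this
          omega
      · have l1 : β < (β.1, β.2 + 1) := lt_of_coords le_rfl (by simp) (by simp)
        have l2 : (β.1, β.2 + 1) < α := lt_of_coords (by simp; omega) (by simp; omega) (by simp; omega)
        obtain ⟨w, hw⟩ := Option.ne_none_iff_exists'.1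
          (hc β α _ l1.le l2.le (by simp [hb]) (by simp [hα]))
        have k1 := hT _ _ _ _ l1 hb hw
        have k2 := hT _ _ _ _ l2 hw hα
        rcases w with z | ⟨⟩
        · have := hg α _ x z hα hw hlt
          simp only [dotKey] at k2
          omega
        · simp only [dotKey] at k1
          omega
  · simp [hα] at ha
  · obtain rfl : x = s := by simpa [hα] using ha'
    have hcov := hT.covBy_of_neighbor hδ ha hδs
    rcases swapVal_cases (Sum.inl x) (Sum.inr ()) T β with hb | ⟨-, hb, -⟩ | ⟨-, hb, -⟩
    · refine hg δ β x y hδs (hb ▸ hβ) ?_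
      have := hcov.le.1
      omega
    · simp [hβ] at hb
    · obtain rfl : y = x := by simpa [hβ] using hb
      exact le_rfl

lemma NoRowDescent.of_swapVal {s : ℤ} {T : ℕ × ℕ → Option ZDot} (hT : DotIncreasing s T)
    (hc : ConvexShape T)
    (hg : NoRowDescent (restrictInt (_root_.swapVal (Sum.inl s) (Sum.inr ()) T))) :
    NoRowDescent (restrictInt T) := by
  simp only [NoRowDescent, restrictInt_eq_some] at hg ⊢
  intro α β x y hα hβ hlt
  rcases swapVal_cases (Sum.inl s) (Sum.inr ()) T α with
    ha | ⟨ha, ha', δ, hδ, hδs⟩ | ⟨ha, -⟩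
  · rw [← ha] at hα
    rcases swapVal_cases (Sum.inl s) (Sum.inr ()) T β with
      hb | ⟨hb, hb', δ, hδ, hδs⟩ | ⟨hb, -⟩
    · exact hg α β x y hα (hb ▸ hβ) hlt
    · obtain rfl : y = s := by simpa [hβ] using hb
      have hcov := hT.covBy_of_neighbor hδ.symm hδs hb
      refine hg α δ x y hα (swapVal_right (by simp) hδs hβ hδ.symm) ?_
      have := hcov.le.1
      omega
    · simp [hβ] at hb
  · obtain rfl : x = s := by simpa [hα] using ha
    by_cases hyx : y = x
    · exact hyx.ge
    have hβ' : _root_.swapVal (Sum.inl x) (Sum.inr ()) T β = some (Sum.inl y) :=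
      swapVal_of_ne hβ (by simpa using hyx) (by simp)
    have hcov := hT.covBy_of_neighbor hδ.symm hδs hα
    have hδ' := swapVal_right (by simp) hδs hα hδ.symm
    by_cases h1 : β.1 < δ.1
    · exact hg δ β x y hδ' hβ' h1
    rcases covBy_cases hcov with ⟨e1, e2⟩ | ⟨e1, e2⟩
    · omega
    by_cases h2 : δ.2 ≤ β.2
    · by_cases h3 : δ.2 = β.2
      · have : δ = β := Prod.ext (by omega) h3
        subst this
        simp [hβ] at hδs
      · have := hT _ _ _ _ (lt_of_coords (α := δ) (β := β) (by omega) h2 (by omega)) hδs hβ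
        simp only [dotKey] at this
        omega
    · have l1 : β < (α.1, α.2 - 1) := lt_of_coords (by simp; omega) (by simp; omega) (by simp; omega)
      have l2 : (α.1, α.2 - 1) < α := lt_of_coords (by simp) (by simp) (by simp; omega)
      obtain ⟨w, hw⟩ := Option.ne_none_iff_exists'.1
        (hc β α _ l1.le l2.le (by simp [hβ]) (by simp [hα]))
      have k1 := hT _ _ _ _ l1 hβ hw
      have k2 := hT _ _ _ _ l2 hw hα
      rcases w with z | ⟨⟩
      · simp only [dotKey] at k1 k2
        have := hg _ β z y (swapVal_of_ne hw (by simp; omega) (by simp)) hβ' hlt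
        omega
      · exact hg _ β x y (swapVal_right (by simp) hw hα
          (Or.inl (hT.covBy hc l2 hw hα))) hβ' hlt
  · simp [hα] at ha

lemma swapUp_invariants {a : ℤ} {T : ℕ × ℕ → Option ZDot} (hT : DotIncreasing a T)
    (hc : ConvexShape T) (n : ℕ) :
    DotIncreasing (a + n) (swapUp a n T) ∧ ConvexShape (swapUp a n T) ∧
      (∀ α, swapUp a n T α ≠ none ↔ T α ≠ none) ∧
      (NoRowDescent (restrictInt (swapUp a n T)) ↔ NoRowDescent (restrictInt T)) ∧
      ∀ x, (∃ α, swapUp a n T α = some (Sum.inl x)) ↔ ∃ α, T α = some (Sum.inl x) := by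
  induction n with
  | zero => simpa [swapUp] using ⟨hT, hc⟩
  | succ n ih =>
    obtain ⟨h1, h2, h3, h4, h5⟩ := ih
    refine ⟨?_, h2.swapVal, fun α => swapVal_ne_none.trans (h3 α), Iff.trans ⟨?_, ?_⟩ h4,
      fun x => (exists_swapVal_eq_some _ _ _).trans (h5 x)⟩
    · have := h1.swapVal h2
      rwa [add_assoc, ← Nat.cast_succ] at this
    · exact NoRowDescent.of_swapVal h1 h2
    · exact NoRowDescent.swapVal h1 h2

/-- A forward slide of an increasing tableau along `C` yields an increasing tableau, whose inner
shape has lost `C`, with the same values and the same absence of row descents. -/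
lemma forwardSlide_spec {T : ℕ × ℕ → Option ℤ} (hT : Increasing T)
    {lam nu C : Finset (ℕ × ℕ)} {a b : ℤ} (hs : IsSkewPair lam nu)
    (hsh : shapeOf T = (nu : Set (ℕ × ℕ)) \ (lam : Set (ℕ × ℕ))) (hv : ValuesIn T a b)
    (hC : ∀ c ∈ C, c ∈ lam ∧ ∀ d ∈ lam, ¬ c < d)
    {T' : ℕ × ℕ → Option ℤ}
    (hT' : T' = restrictInt (swapUp a (b - a + 1).toNat (addDots C (toDotted T)))) :
    Increasing T' ∧ (NoRowDescent T' ↔ NoRowDescent T) ∧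
      (∀ x, (∃ α, T' α = some x) ↔ ∃ α, T α = some x) ∧
      ∃ nu', IsSkewPair (lam \ C) nu' ∧
        shapeOf T' = (nu' : Set (ℕ × ℕ)) \ ((lam \ C : Finset (ℕ × ℕ)) : Set (ℕ × ℕ)) := by
  obtain ⟨hl, hn, hln⟩ := hs
  have hshape : ∀ α, T α ≠ none ↔ α ∈ nu ∧ α ∉ lam := fun α => by
    have : α ∈ shapeOf T ↔ _ := Set.ext_iff.1 hsh α
    simpa [shapeOf] using this
  set D := addDots C (toDotted T) with hD
  have hDint : ∀ α x, D α = some (Sum.inl x) ↔ T α = some x := by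
    intro α x
    simp only [hD, addDots, toDotted]
    split_ifs with h
    · have : T α = none := by
        by_contra h'
        exact ((hshape α).1 h').2 (hC α h).1
      simp [this]
    · simp
  have hDdot : ∀ α, D α = some (Sum.inr ()) ↔ α ∈ C := by
    intro α
    simp only [hD, addDots, toDotted]
    split_ifs with h <;> simp [h]
  have hDdom : ∀ α, D α ≠ none ↔ α ∈ nu ∧ α ∉ lam \ C := by
    intro α
    have h1 := hshape α
    simp only [hD, addDots, toDotted]
    split_ifs with h
    · simp [h, hln (hC α h).1]
    · simpa [h] using h1
  have hrest : restrictInt D = T := by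
    funext α
    refine Option.ext fun x => ?_
    exact restrictInt_eq_some.trans (hDint α x)
  have hlC : StraightShape (lam \ C) := by
    intro x hx y hyx
    rw [Finset.mem_sdiff] at hx ⊢
    refine ⟨hl x hx.1 y hyx, fun hy => ?_⟩
    rcases hyx.eq_or_lt with rfl | h
    · exact hx.2 hy
    · exact (hC y hy).2 x hx.1 h
  have hDc : ConvexShape D := by
    intro α β γ h1 h2 hα hβ
    rw [hDdom] at *
    exact ⟨hn β hβ.1 γ h2, fun h => hα.2 (hlC γ h α h1)⟩
  have hDi : DotIncreasing a D := by
    intro α β u v hlt hu hv'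
    rcases u with x | ⟨⟩ <;> rcases v with y | ⟨⟩
    · have := hT α β hlt x y ((hDint _ _).1 hu) ((hDint _ _).1 hv')
      simp only [dotKey]; omega
    · have h1 := (hshape α).1 (by rw [(hDint _ _).1 hu]; simp)
      exact absurd (hl β (hC β ((hDdot β).1 hv')).1 α hlt.le) h1.2
    · have := (hv β y ((hDint _ _).1 hv')).1
      simp only [dotKey]; omega
    · exact absurd hlt ((hC α ((hDdot α).1 hu)).2 β (hC β ((hDdot β).1 hv')).1)
  obtain ⟨h1, h2, h3, h4, h5⟩ := swapUp_invariants hDi hDc (b - a + 1).toNat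
  set S := swapUp a (b - a + 1).toNat D
  rw [hrest] at h4
  have hval : ∀ x, (∃ α, T' α = some x) ↔ ∃ α, T α = some x := by
    intro x
    subst hT'
    simp only [restrictInt_eq_some, h5, hDint]
  have hdotmax : ∀ α β, α < β → S α = some (Sum.inr ()) → S β = none := by
    intro α β hlt hα
    by_contra hne
    obtain ⟨v, hvv⟩ := Option.ne_none_iff_exists'.1 hne
    have := h1 _ _ _ _ hlt hα hvv
    rcases v with y | ⟨⟩
    · obtain ⟨γ, hγ⟩ := (h5 y).1 ⟨β, hvv⟩
      have := (hv γ y ((hDint _ _).1 hγ))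
      simp only [dotKey] at *
      omega
    · simp [dotKey] at this
  refine ⟨?_, by rw [hT']; exact h4, hval,
    nu.filter (fun α => S α ≠ some (Sum.inr ())), ⟨hlC, ?_, ?_⟩, ?_⟩
  · subst hT'
    intro α β hlt x y hx hy
    rw [restrictInt_eq_some] at hx hy
    have := h1 _ _ _ _ hlt hx hy
    simp only [dotKey] at this
    omega
  · intro α hα β hle
    rw [Finset.mem_filter] at hα ⊢
    refine ⟨hn α hα.1 β hle, fun hβ => ?_⟩
    rcases hle.eq_or_lt with rfl | hlt
    · exact hα.2 hβ
    have hnone := hdotmax β α hlt hβ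
    have hβd := ((hDdom β).1 ((h3 β).1 (by simp [hβ]))).2
    have hαd : ¬ (α ∈ nu ∧ α ∉ lam \ C) := by
      rw [← hDdom, ← h3]; simpa using hnone
    exact hβd (hlC α (by_contra fun h => hαd ⟨hα.1, h⟩) β hle)
  · intro α hα
    rw [Finset.mem_filter]
    refine ⟨hln (Finset.mem_sdiff.1 hα).1, fun h => ?_⟩
    exact ((hDdom α).1 ((h3 α).1 (by simp [h]))).2 hα
  · ext α
    have h6 := (h3 α).trans (hDdom α)
    simp only [Set.mem_sdiff, Finset.mem_coe, Finset.mem_filter]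
    have h7 : α ∈ shapeOf T' ↔ S α ≠ none ∧ S α ≠ some (Sum.inr ()) := by
      subst hT'
      simp only [shapeOf, Set.mem_ofPred_eq, restrictInt]
      rcases S α with _ | _ | _ <;> simp
    rw [h7, h6]
    tauto

/-- Relation between a tableau and the tableaux obtained from it by forward slides. -/
lemma forwardSlides_spec {T U : ℕ × ℕ → Option ℤ} (hT : Increasing T)
    (h : Relation.ReflTransGen IsForwardSlide T U) :
    Increasing U ∧ (NoRowDescent U ↔ NoRowDescent T) ∧
      ∀ x, (∃ α, U α = some x) ↔ ∃ α, T α = some x := by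
  induction h with
  | refl => exact ⟨hT, Iff.rfl, fun _ => Iff.rfl⟩
  | tail _ h ih =>
    obtain ⟨lam, nu, C, a, b, hs, hsh, hv, hC, hU⟩ := h
    obtain ⟨h1, h2, h3, -⟩ := forwardSlide_spec ih.1 hs hsh hv hC hU
    exact ⟨h1, h2.trans ih.2.1, fun x => (h3 x).trans (ih.2.2 x)⟩

lemma exists_rectification {T : ℕ × ℕ → Option ℤ} (hT : Increasing T) {a b : ℤ}
    (hv : ValuesIn T a b) {lam nu : Finset (ℕ × ℕ)} (hs : IsSkewPair lam nu)
    (hsh : shapeOf T = (nu : Set (ℕ × ℕ)) \ (lam : Set (ℕ × ℕ))) :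
    ∃ U, RectifiesTo T U := by
  induction hk : lam.card using Nat.strong_induction_on generalizing T lam nu with
  | _ k ih =>
    rcases lam.eq_empty_or_nonempty with rfl | hne
    · exact ⟨T, Relation.ReflTransGen.refl, nu, hs.2.1, by simpa using hsh⟩
    obtain ⟨c, hc⟩ := lam.exists_maximal hne
    have hC : ∀ d ∈ ({c} : Finset (ℕ × ℕ)), d ∈ lam ∧ ∀ e ∈ lam, ¬ d < e := by
      simpa using ⟨hc.1, fun i j he hlt => hlt.not_ge (hc.2 he hlt.le)⟩
    obtain ⟨h1, -, h3, nu', h4, h5⟩ := forwardSlide_spec hT hs hsh hv hC rfl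
    have hlt : (lam \ {c}).card < k := by
      rw [← hk]
      exact Finset.card_lt_card (Finset.sdiff_ssubset (by simpa using hc.1) (by simp))
    obtain ⟨U, hU, hU'⟩ := ih _ hlt h1 (fun α x hx => by
      obtain ⟨β, hβ⟩ := (h3 x).1 ⟨α, hx⟩
      exact hv β x hβ) h4 h5 rfl
    exact ⟨U, Relation.ReflTransGen.head ⟨lam, nu, {c}, a, b, hs, hsh, hv, hC, rfl⟩ hU, hU'⟩

lemma eq_rowTab {U : ℕ × ℕ → Option ℤ} {p : ℕ} (hU : Increasing U) (hg : NoRowDescent U)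
    (hv : ∀ x : ℤ, (∃ α, U α = some x) ↔ 1 ≤ x ∧ x ≤ p) (hs : HasStraightShape U) :
    U = rowTab p := by
  obtain ⟨mu, hmu, hsh⟩ := hs
  have hshape : ∀ α, U α ≠ none ↔ α ∈ mu := fun α => Set.ext_iff.1 hsh α
  have hdown : ∀ {α β x}, U α = some x → β ≤ α → ∃ y, U β = some y := fun {α β x} hα h =>
    Option.ne_none_iff_exists'.1 ((hshape β).2 (hmu α ((hshape α).1 (by simp [hα])) β h))
  have hrow : ∀ α x, U α = some x → α.1 = 0 := by
    intro α x hα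
    by_contra h
    have hlt : ((0, α.2) : ℕ × ℕ) < α := lt_of_coords (by simp) (by simp) (by simp; omega)
    obtain ⟨y, hy⟩ := hdown hα hlt.le
    have h1 := hU _ _ hlt _ _ hy hα
    have h2 := hg _ _ _ _ hα hy (by simp; omega)
    omega
  have hvalue : ∀ (j : ℕ) (x : ℤ), U (0, j) = some x → x = j + 1 := by
    intro j
    induction j using Nat.strong_induction_on with
    | _ j ih =>
      intro x hx
      have hbd := (hv x).1 ⟨_, hx⟩
      have hge : (j : ℤ) + 1 ≤ x := by
        rcases j with _ | j
        · simpa using hbd.1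
        · have hlt : ((0, j) : ℕ × ℕ) < (0, j + 1) := lt_of_coords (by simp) (by simp) (by simp)
          obtain ⟨y, hy⟩ := hdown hx hlt.le
          have := ih j (by omega) y hy
          have := hU _ _ hlt _ _ hy hx
          push_cast
          omega
      obtain ⟨⟨i, k⟩, hk⟩ := (hv ((j : ℤ) + 1)).2 ⟨by omega, by omega⟩
      obtain rfl : i = 0 := hrow _ _ hk
      rcases lt_trichotomy k j with h | rfl | h
      · have := ih k h _ hk
        omega
      · rw [hx] at hk
        exact Option.some.inj hk
      · have := hU _ _ (lt_of_coords (α := (0, j)) (β := (0, k)) le_rfl h.le (Or.inr h)) _ _ hx hk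
        omega
  funext ⟨i, j⟩
  refine Option.ext fun x => ?_
  simp only [rowTab, Option.ite_none_right_eq_some, Option.some.injEq]
  constructor
  · intro hx
    obtain rfl : i = 0 := hrow _ _ hx
    have h1 := hvalue j x hx
    have h2 := (hv x).1 ⟨_, hx⟩
    exact ⟨⟨rfl, by omega⟩, h1.symm⟩
  · rintro ⟨⟨rfl, hj⟩, rfl⟩
    obtain ⟨⟨i, k⟩, hk⟩ := (hv ((j : ℤ) + 1)).2 ⟨by omega, by omega⟩
    obtain rfl : i = 0 := hrow _ _ hk
    have := hvalue k _ hk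
    obtain rfl : k = j := by omega
    exact hk

lemma rectifiesTo_rowTab_iff {T : ℕ × ℕ → Option ℤ} (hT : Increasing T) {p : ℕ}
    {lam nu : Finset (ℕ × ℕ)} (hs : IsSkewPair lam nu)
    (hsh : shapeOf T = (nu : Set (ℕ × ℕ)) \ (lam : Set (ℕ × ℕ))) :
    RectifiesTo T (rowTab p) ↔
      NoRowDescent T ∧ ∀ x : ℤ, (∃ α, T α = some x) ↔ 1 ≤ x ∧ x ≤ p := by
  constructor
  · rintro ⟨h, -⟩
    obtain ⟨-, h1, h2⟩ := forwardSlides_spec hT h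
    refine ⟨h1.1 ?_, fun x => (h2 x).symm.trans ⟨?_, ?_⟩⟩
    · intro α β x y hα hβ hlt
      simp only [rowTab, Option.ite_none_right_eq_some] at hα hβ
      omega
    · rintro ⟨α, hα⟩
      simp only [rowTab, Option.ite_none_right_eq_some, Option.some.injEq] at hα
      omega
    · rintro ⟨hx1, hx2⟩
      obtain ⟨n, rfl⟩ := Int.exists_add_of_le hx1
      refine ⟨(0, n), ?_⟩
      simp only [rowTab, Option.ite_none_right_eq_some, Option.some.injEq, true_and]
      omega
  · rintro ⟨hg, hv⟩
    obtain ⟨U, hU⟩ := exists_rectification hT (a := 1) (b := p)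
      (fun α x hx => (hv x).1 ⟨α, hx⟩) hs hsh
    obtain ⟨h1, h2, h3⟩ := forwardSlides_spec hT hU.1
    rwa [eq_rowTab h1 (h2.2 hg) (fun x => (h3 x).trans (hv x)) hU.2] at hU

/-- Fillings of `B` with set of values `{1, …, p}`, weakly increasing from left to right and
strictly increasing along rows. -/
def rowFillings (B : Finset (ℕ × ℕ)) (p : ℕ) : Set (ℕ × ℕ → Option ℤ) :=
  {T | (∀ α, T α ≠ none ↔ α ∈ B) ∧
    (∀ α β x y, T α = some x → T β = some y → α.2 < β.2 → x ≤ y ∧ (α.1 = β.1 → x < y)) ∧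
    ∀ x : ℤ, (∃ α, T α = some x) ↔ 1 ≤ x ∧ x ≤ p}

lemma rowFillings_empty_zero : rowFillings ∅ 0 = {fun _ => none} := by
  ext T
  simp only [rowFillings, Set.mem_ofPred_eq, Set.mem_singleton_iff]
  constructor
  · rintro ⟨h, -⟩
    funext α
    simpa using h α
  · rintro rfl
    refine ⟨by simp, by simp, fun x => ?_⟩
    simp
    omega

lemma rowFillings_empty_succ (p : ℕ) : rowFillings ∅ (p + 1) = ∅ := by
  ext T
  simp only [rowFillings, Set.mem_ofPred_eq, Set.mem_empty_iff_false, iff_false]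
  rintro ⟨h, -, hv⟩
  obtain ⟨α, hα⟩ := (hv 1).2 ⟨le_rfl, by push_cast; omega⟩
  simpa [hα] using h α

lemma rowFillings_zero {B : Finset (ℕ × ℕ)} (hB : B.Nonempty) : rowFillings B 0 = ∅ := by
  ext T
  simp only [rowFillings, Set.mem_ofPred_eq, Set.mem_empty_iff_false, iff_false]
  rintro ⟨h, -, hv⟩
  obtain ⟨α, hα⟩ := hB
  obtain ⟨x, hx⟩ := Option.ne_none_iff_exists'.1 ((h α).2 hα)
  have := (hv x).1 ⟨α, hx⟩
  simp at this
  omega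

lemma update_mem_rowFillings {B : Finset (ℕ × ℕ)} {ω : ℕ × ℕ} (hω : ω ∉ B)
    (hmax : ∀ γ ∈ B, γ.2 < ω.2) {p q : ℕ} {T : ℕ × ℕ → Option ℤ} (hT : T ∈ rowFillings B q)
    (hq : q = p ∨ q = p + 1 ∧ ω.1 ∉ B.image Prod.fst) :
    Function.update T ω (some ((p + 1 : ℕ) : ℤ)) ∈ rowFillings (insert ω B) (p + 1) := by
  obtain ⟨h1, h2, h3⟩ := hT
  have hTω : T ω = none := by
    by_contra h
    exact hω ((h1 ω).1 h)
  refine ⟨fun α => ?_, fun α β x y hα hβ hlt => ?_, fun x => ?_⟩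
  · by_cases h : α = ω
    · simp [h]
    · simpa [h] using h1 α
  · by_cases hαω : α = ω
    · subst hαω
      have hne : β ≠ α := by rintro rfl; omega
      rw [Function.update_of_ne hne] at hβ
      have := hmax β ((h1 β).1 (by simp [hβ]))
      omega
    rw [Function.update_of_ne hαω] at hα
    by_cases hβω : β = ω
    · subst hβω
      obtain rfl : ((p + 1 : ℕ) : ℤ) = y := by simpa using hβ
      have hb := (h3 x).1 ⟨α, hα⟩
      rcases hq with rfl | ⟨rfl, hr⟩
      · push_cast
        omega
      · refine ⟨hb.2, fun h => absurd ?_ hr⟩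
        exact Finset.mem_image.2 ⟨α, (h1 α).1 (by simp [hα]), h⟩
    · rw [Function.update_of_ne hβω] at hβ
      exact h2 α β x y hα hβ hlt
  · have hex : (∃ α, Function.update T ω (some ((p + 1 : ℕ) : ℤ)) α = some x) ↔
        x = ((p + 1 : ℕ) : ℤ) ∨ ∃ α, T α = some x := by
      constructor
      · rintro ⟨α, hα⟩
        by_cases h : α = ω
        · subst h
          left
          simpa using hα.symm
        · rw [Function.update_of_ne h] at hα
          exact Or.inr ⟨α, hα⟩
      · rintro (rfl | ⟨α, hα⟩)
        · exact ⟨ω, by simp⟩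
        · have h : α ≠ ω := by
            rintro rfl
            simp [hTω] at hα
          exact ⟨α, by rwa [Function.update_of_ne h]⟩
    rw [hex, h3]
    rcases hq with rfl | ⟨rfl, -⟩ <;> push_cast <;> omega

lemma mem_rowFillings_insert {B : Finset (ℕ × ℕ)} {ω : ℕ × ℕ} (hω : ω ∉ B)
    (hmax : ∀ γ ∈ B, γ.2 < ω.2)
    (hrow : ∀ α ∈ insert ω B, ∀ β ∈ insert ω B, α.2 < β.2 → β.1 ≤ α.1)
    (hcol : ∀ α ∈ insert ω B, ∀ β ∈ insert ω B, α.2 = β.2 → α = β)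
    {p : ℕ} {T : ℕ × ℕ → Option ℤ} (hT : T ∈ rowFillings (insert ω B) (p + 1)) :
    ∃ q T₀, T₀ ∈ rowFillings B q ∧ (q = p ∨ q = p + 1 ∧ ω.1 ∉ B.image Prod.fst) ∧
      Function.update T₀ ω (some ((p + 1 : ℕ) : ℤ)) = T := by
  obtain ⟨h1, h2, h3⟩ := hT
  obtain ⟨w, hw⟩ := Option.ne_none_iff_exists'.1 ((h1 ω).2 (by simp))
  have hle : ∀ α x, T α = some x → x ≤ w := by
    intro α x hα
    have hmem := (h1 α).1 (by simp [hα])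
    rcases Finset.mem_insert.1 hmem with rfl | hB
    · rw [hw] at hα
      exact (Option.some.inj hα).ge
    · exact (h2 α ω x w hα hw (hmax α hB)).1
  have hwp : w = ((p + 1 : ℕ) : ℤ) := by
    obtain ⟨α, hα⟩ := (h3 ((p + 1 : ℕ) : ℤ)).2 ⟨by push_cast; omega, le_rfl⟩
    exact le_antisymm ((h3 w).1 ⟨ω, hw⟩).2 (hle _ _ hα)
  set T₀ := Function.update T ω none with hT₀
  have hback : Function.update T₀ ω (some ((p + 1 : ℕ) : ℤ)) = T := by
    rw [hT₀, Function.update_idem, ← hwp, ← hw, Function.update_eq_self]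
  have hT₀some : ∀ α x, T₀ α = some x ↔ α ≠ ω ∧ T α = some x := by
    intro α x
    by_cases h : α = ω
    · simp [hT₀, h]
    · simp [hT₀, h]
  have hdom : ∀ α, T₀ α ≠ none ↔ α ∈ B := by
    intro α
    by_cases h : α = ω
    · simp [hT₀, h, hω]
    · simpa [hT₀, h] using h1 α
  have hmono : ∀ α β x y, T₀ α = some x → T₀ β = some y → α.2 < β.2 →
      x ≤ y ∧ (α.1 = β.1 → x < y) := fun α β x y hα hβ =>
    h2 α β x y ((hT₀some _ _).1 hα).2 ((hT₀some _ _).1 hβ).2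
  have hval : ∀ x, (∃ α, T α = some x) ↔ x = w ∨ ∃ α, T₀ α = some x := by
    intro x
    constructor
    · rintro ⟨α, hα⟩
      by_cases h : α = ω
      · subst h
        rw [hw] at hα
        exact Or.inl (Option.some.inj hα).symm
      · exact Or.inr ⟨α, (hT₀some _ _).2 ⟨h, hα⟩⟩
    · rintro (rfl | ⟨α, hα⟩)
      · exact ⟨ω, hw⟩
      · exact ⟨α, ((hT₀some _ _).1 hα).2⟩
  simp only [hval] at h3
  by_cases hrep : ∃ α, T₀ α = some w
  · refine ⟨p + 1, T₀, ⟨hdom, hmono, fun x => ?_⟩, Or.inr ⟨rfl, fun hr => ?_⟩, hback⟩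
    · rw [← h3 x]
      refine ⟨Or.inr, ?_⟩
      rintro (rfl | h)
      exacts [hrep, h]
    · obtain ⟨γ, hγ⟩ := hrep
      obtain ⟨δ, hδB, hδω⟩ := Finset.mem_image.1 hr
      have hγB := (hdom γ).1 (by simp [hγ])
      obtain ⟨y, hy⟩ := Option.ne_none_iff_exists'.1 ((hdom δ).2 hδB)
      have hyw := (h2 δ ω y w ((hT₀some _ _).1 hy).2 hw (hmax δ hδB)).2 hδω
      rcases lt_trichotomy γ.2 δ.2 with h | h | h
      · have := (hmono _ _ _ _ hγ hy h).1
        omega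
      · obtain rfl := hcol γ (Finset.mem_insert_of_mem hγB) δ (Finset.mem_insert_of_mem hδB) h
        rw [hγ] at hy
        have := Option.some.inj hy
        omega
      · have e1 := hrow δ (Finset.mem_insert_of_mem hδB) γ (Finset.mem_insert_of_mem hγB) h
        have e2 := hrow γ (Finset.mem_insert_of_mem hγB) ω (Finset.mem_insert_self _ _)
          (hmax γ hγB)
        have := (h2 γ ω w w ((hT₀some _ _).1 hγ).2 hw (hmax γ hγB)).2 (by omega)
        omega
  · refine ⟨p, T₀, ⟨hdom, hmono, fun x => ?_⟩, Or.inl rfl, hback⟩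
    have h := h3 x
    push_cast at h hwp
    constructor
    · intro hx
      have hne : x ≠ w := by
        rintro rfl
        exact hrep hx
      have := h.1 (Or.inr hx)
      omega
    · intro hx
      exact (h.2 (by omega)).resolve_left (by omega)

lemma rowFillings_disjoint {B : Finset (ℕ × ℕ)} {p q : ℕ} (hpq : p < q) :
    Disjoint (rowFillings B p) (rowFillings B q) := by
  rw [Set.disjoint_left]
  rintro T ⟨-, -, h⟩ ⟨-, -, h'⟩
  have := (h q).1 ((h' q).2 ⟨by omega, le_rfl⟩)
  omega

lemma ncard_rowFillings (B : Finset (ℕ × ℕ))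
    (hrow : ∀ α ∈ B, ∀ β ∈ B, α.2 < β.2 → β.1 ≤ α.1)
    (hcol : ∀ α ∈ B, ∀ β ∈ B, α.2 = β.2 → α = β) (p : ℕ) :
    (rowFillings B p).Finite ∧ (rowFillings B p).ncard =
      if p ≤ B.card then ((B.image Prod.fst).card - 1).choose (B.card - p) else 0 := by
  induction B using Finset.induction_on_max_value (fun α : ℕ × ℕ => α.2) generalizing p with
  | empty =>
    rcases p with _ | p
    · simp [rowFillings_empty_zero]
    · simp [rowFillings_empty_succ]
  | insert ω B hω hle ih =>
    have hmax : ∀ γ ∈ B, γ.2 < ω.2 := fun γ hγ => lt_of_le_of_ne (hle γ hγ) fun h =>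
      hω (hcol γ (Finset.mem_insert_of_mem hγ) ω (Finset.mem_insert_self _ _) h ▸ hγ)
    replace ih := ih (fun α hα β hβ => hrow α (Finset.mem_insert_of_mem hα) β
      (Finset.mem_insert_of_mem hβ)) (fun α hα β hβ => hcol α (Finset.mem_insert_of_mem hα) β
      (Finset.mem_insert_of_mem hβ))
    have hcard : (insert ω B).card = B.card + 1 := Finset.card_insert_of_notMem hω
    rcases p with _ | p
    · rw [rowFillings_zero (Finset.insert_nonempty _ _)]
      have : ((insert ω B).image Prod.fst).card ≤ (insert ω B).card := Finset.card_image_le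
      refine ⟨Set.finite_empty, ?_⟩
      rw [if_pos (Nat.zero_le _), Nat.choose_eq_zero_of_lt (by omega), Set.ncard_empty]
    set S := rowFillings B p ∪
      if ω.1 ∈ B.image Prod.fst then ∅ else rowFillings B (p + 1) with hS
    have hmemS : ∀ T, T ∈ S ↔ ∃ q, T ∈ rowFillings B q ∧
        (q = p ∨ q = p + 1 ∧ ω.1 ∉ B.image Prod.fst) := by
      intro T
      rw [hS]
      split_ifs with h
      · simp [h]
      · simp only [Set.mem_union]
        constructor
        · rintro (h' | h')
          exacts [⟨p, h', Or.inl rfl⟩, ⟨p + 1, h', Or.inr ⟨rfl, h⟩⟩]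
        · rintro ⟨q, h', rfl | ⟨rfl, -⟩⟩
          exacts [Or.inl h', Or.inr h']
    have himage : rowFillings (insert ω B) (p + 1) =
        (fun T => Function.update T ω (some ((p + 1 : ℕ) : ℤ))) '' S := by
      ext T
      constructor
      · intro hT
        obtain ⟨q, T₀, h1, h2, h3⟩ := mem_rowFillings_insert hω hmax hrow hcol hT
        exact ⟨T₀, (hmemS _).2 ⟨q, h1, h2⟩, h3⟩
      · rintro ⟨T₀, h, rfl⟩
        obtain ⟨q, h1, h2⟩ := (hmemS _).1 h
        exact update_mem_rowFillings hω hmax h1 h2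
    have hinj : Set.InjOn (fun T : ℕ × ℕ → Option ℤ =>
        Function.update T ω (some ((p + 1 : ℕ) : ℤ))) S := by
      have hnone : ∀ T ∈ S, T ω = none := by
        intro T hT
        obtain ⟨q, h1, -⟩ := (hmemS _).1 hT
        by_contra h
        exact hω ((h1.1 ω).1 h)
      intro T hT T' hT' heq
      funext α
      by_cases h : α = ω
      · rw [h, hnone T hT, hnone T' hT']
      · simpa [h] using congrFun heq α
    have hSfin : S.Finite := by
      refine (ih p).1.union ?_
      split_ifs
      exacts [Set.finite_empty, (ih (p + 1)).1]
    refine ⟨himage ▸ hSfin.image _, ?_⟩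
    rw [himage, hinj.ncard_image, hS, hcard, Finset.image_insert]
    split_ifs with hmem hp hp
    · rw [Set.union_empty, (ih p).2, if_pos (by omega), Finset.insert_eq_of_mem hmem,
        Nat.add_sub_add_right]
    · rw [Set.union_empty, (ih p).2, if_neg (by omega)]
    all_goals
      rw [Set.ncard_union_eq (rowFillings_disjoint (Nat.lt_succ_self p)) (ih p).1 (ih (p + 1)).1,
        (ih p).2, (ih (p + 1)).2]
    · rw [if_pos (by omega), Finset.card_insert_of_notMem hmem, Nat.add_sub_cancel,
        Nat.add_sub_add_right]
      rcases B.eq_empty_or_nonempty with rfl | hB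
      · obtain rfl : p = 0 := by simpa using hp
        simp
      have hpos : 0 < (B.image Prod.fst).card := (hB.image _).card_pos
      obtain ⟨r, hr⟩ := Nat.exists_eq_succ_of_ne_zero hpos.ne'
      rw [hr]
      split_ifs with hp'
      · obtain ⟨m, hm⟩ : ∃ m, B.card - p = m + 1 := ⟨B.card - p - 1, by omega⟩
        rw [hm, show B.card - (p + 1) = m by omega, Nat.succ_sub_one, Nat.choose_succ_succ,
          add_comm]
      · rw [show B.card - p = 0 by omega]
        simp
    · rw [if_neg (by omega), if_neg (by omega)]

theorem pieri_rule_typeA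
    (lam nu : Finset (ℕ × ℕ)) (hl : StraightShape lam) (hn : StraightShape nu)
    (hln : lam ⊆ nu) (p : ℕ) (hp : 0 < p) :
    Set.ncard {T : ℕ × ℕ → Option ℤ | Increasing T ∧
        shapeOf T = ((nu : Set (ℕ × ℕ)) \ (lam : Set (ℕ × ℕ))) ∧
        RectifiesTo T (rowTab p)} =
      if (nu \ lam).Nonempty ∧
          (∀ q ∈ nu \ lam, ∀ q' ∈ nu \ lam, q.2 = q'.2 → q = q') then
        (if p ≤ (nu \ lam).card then
          Nat.choose (((nu \ lam).image Prod.fst).card - 1) ((nu \ lam).card - p)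
        else 0)
      else 0 := by
  have hs : IsSkewPair lam nu := ⟨hl, hn, hln⟩
  set B := nu \ lam with hB
  have hset : {T : ℕ × ℕ → Option ℤ | Increasing T ∧
        shapeOf T = ((nu : Set (ℕ × ℕ)) \ (lam : Set (ℕ × ℕ))) ∧ RectifiesTo T (rowTab p)} =
      {T | Increasing T ∧ (∀ α, T α ≠ none ↔ α ∈ B) ∧ NoRowDescent T ∧
        ∀ x : ℤ, (∃ α, T α = some x) ↔ 1 ≤ x ∧ x ≤ p} := by
    ext T
    refine and_congr_right fun hT => ?_
    have hiff : shapeOf T = ((nu : Set (ℕ × ℕ)) \ (lam : Set (ℕ × ℕ))) ↔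
        ∀ α, T α ≠ none ↔ α ∈ B := by
      simp [Set.ext_iff, shapeOf, hB]
    rw [← hiff]
    exact and_congr_right fun h => rectifiesTo_rowTab_iff hT hs h
  rw [hset]
  by_cases hstrip : B.Nonempty ∧ ∀ q ∈ B, ∀ q' ∈ B, q.2 = q'.2 → q = q'
  · rw [if_pos hstrip]
    have hcol := hstrip.2
    have hrow : ∀ α ∈ B, ∀ β ∈ B, α.2 < β.2 → β.1 ≤ α.1 := by
      intro α hα β hβ hlt
      by_contra! h
      have hα' := Finset.mem_sdiff.1 hα
      have hmem : (α.1, β.2) ∈ B := Finset.mem_sdiff.2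
        ⟨hn β (Finset.mem_sdiff.1 hβ).1 _ ⟨h.le, le_rfl⟩,
          fun h' => hα'.2 (hl _ h' α ⟨le_rfl, hlt.le⟩)⟩
      have := congrArg Prod.fst (hcol _ hmem β hβ rfl)
      simp only at this
      omega
    rw [← (ncard_rowFillings B hrow hcol p).2]
    congr 1
    ext T
    constructor
    · rintro ⟨h1, h2, h3, h4⟩
      refine ⟨h2, fun α β x y hα hβ hlt => ?_, h4⟩
      have hle := hrow α ((h2 α).1 (by simp [hα])) β ((h2 β).1 (by simp [hβ])) hlt
      rcases hle.lt_or_eq with h | h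
      · exact ⟨h3 α β x y hα hβ h, fun h' => by omega⟩
      · have := h1 α β (lt_of_coords h.ge hlt.le (Or.inr hlt)) x y hα hβ
        exact ⟨this.le, fun _ => this⟩
    · rintro ⟨h2, h3, h4⟩
      refine ⟨fun α β hlt x y hα hβ => ?_, h2, fun α β x y hα hβ hlt => ?_, h4⟩
      · have hαB := (h2 α).1 (by simp [hα])
        have hβB := (h2 β).1 (by simp [hβ])
        have hlt2 : α.2 < β.2 := hlt.le.2.lt_of_ne fun h => hlt.ne (hcol α hαB β hβB h)
        exact (h3 α β x y hα hβ hlt2).2 (le_antisymm hlt.le.1 (hrow α hαB β hβB hlt2))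
      · have hαB := (h2 α).1 (by simp [hα])
        have hβB := (h2 β).1 (by simp [hβ])
        refine (h3 α β x y hα hβ ?_).1
        by_contra! h
        rcases h.lt_or_eq with h | h
        · have := hrow β hβB α hαB h
          omega
        · have := hcol β hβB α hαB h
          subst this
          omega
  · rw [if_neg hstrip]
    convert Set.ncard_empty (ℕ × ℕ → Option ℤ)
    rw [Set.eq_empty_iff_forall_notMem]
    rintro T ⟨h1, h2, h3, h4⟩
    apply hstrip
    obtain ⟨α, hα⟩ := (h4 1).2 ⟨le_rfl, by omega⟩
    refine ⟨⟨α, (h2 α).1 (by simp [hα])⟩, ?_⟩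
    have key : ∀ q ∈ B, ∀ q' ∈ B, q.2 = q'.2 → ¬ q.1 < q'.1 := by
      intro q hq q' hq' h hlt
      obtain ⟨x, hx⟩ := Option.ne_none_iff_exists'.1 ((h2 q).2 hq)
      obtain ⟨y, hy⟩ := Option.ne_none_iff_exists'.1 ((h2 q').2 hq')
      have e1 := h1 q q' (lt_of_coords hlt.le h.le (Or.inl hlt)) x y hx hy
      have e2 := h3 q' q y x hy hx hlt
      omega
    intro q hq q' hq' h
    exact Prod.ext (le_antisymm (not_lt.1 (key q' hq' q hq h.symm))
      (not_lt.1 (key q hq q' hq' h))) h
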